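/- Let N ∈ ℕ with N ≥ 3 and s = N/2 (so s > 1). For x, y in the open unit ball with x ≠ y let ρ = (1−|x|²)(1−|y|²)/|x−y|². Then −Δ_x [ k_{N,N/2} ∫_0^{ρ(x,y)} v^{N/2−1}(v+1)^{−N/2} dv ] = G_{N/2−1}(x,y) − 4 k_{N,N/2}(N/2 − 1) P(x,y), where G_{N/2−1}(x,y) = k_{N,N/2−1} |x−y|^{−2} ∫_0^{ρ} v^{N/2−2}(v+1)^{−N/2} dv and P(x,y) = (1−|x|²)^{N/2−2}(1−|y|²)^{N/2−1}(1−|x|²|y|²)/[x,y]^N with [x,y] = √(|x|²|y|²−2⟨x,y⟩+1). -/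

import Mathlib

open MeasureTheory
open scoped RealInnerProductSpace

/-- The (classical, pointwise) Laplacian of `f : ℝ^N → ℝ`, as the sum of the pure
second derivatives in the coordinate directions. -/
noncomputable def lap {N : ℕ} (f : EuclideanSpace ℝ (Fin N) → ℝ)
    (x : EuclideanSpace ℝ (Fin N)) : ℝ :=
  ∑ i : Fin N, iteratedFDeriv ℝ 2 f x ![EuclideanSpace.single i (1:ℝ), EuclideanSpace.single i (1:ℝ)]

/-- The quantity `ρ(x,y) = (1-|x|²)(1-|y|²) / |x-y|²` (for `x, y` in the unit ball). -/
noncomputable def boggioRho {N : ℕ} (x y : EuclideanSpace ℝ (Fin N)) : ℝ :=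
  (1 - ‖x‖ ^ 2) * (1 - ‖y‖ ^ 2) / ‖x - y‖ ^ 2

/-- The constant `k_{N,s} = Γ(N/2)/(π^{N/2} 4^s Γ(s)²)` in Boggio's formula. -/
noncomputable def boggioConst (N : ℕ) (s : ℝ) : ℝ :=
  Real.Gamma ((N : ℝ) / 2) / (Real.pi ^ ((N : ℝ) / 2) * 4 ^ s * (Real.Gamma s) ^ 2)

theorem lap_eq_div {N : ℕ} {f : EuclideanSpace ℝ (Fin N) → ℝ}
    {α β : EuclideanSpace ℝ (Fin N) → ℝ} {α' β' : EuclideanSpace ℝ (Fin N) →L[ℝ] ℝ}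
    {x y : EuclideanSpace ℝ (Fin N)}
    (hf : ∀ᶠ z in nhds x, HasFDerivAt f (innerSL ℝ (α z • z + β z • (z - y))) z)
    (hα : HasFDerivAt α α' x) (hβ : HasFDerivAt β β' x) :
    lap f x = N * (α x + β x) + α' x + β' (x - y) := by
  have hW : HasFDerivAt (fun z => α z • z + β z • (z - y))
      ((α x • ContinuousLinearMap.id ℝ _ + α'.smulRight x) +
        (β x • ContinuousLinearMap.id ℝ _ + β'.smulRight (x - y))) x :=
    (hα.smul (hasFDerivAt_id x)).add (hβ.smul ((hasFDerivAt_id x).sub_const y))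
  have hfd : fderiv ℝ f =ᶠ[nhds x] fun z => innerSL ℝ (α z • z + β z • (z - y)) :=
    hf.mono fun z hz => hz.fderiv
  have h2 := ((innerSL ℝ).hasFDerivAt.comp x hW).congr_of_eventuallyEq hfd
  have key (L : EuclideanSpace ℝ (Fin N) →L[ℝ] ℝ) (w : EuclideanSpace ℝ (Fin N)) :
      ∑ i, L (EuclideanSpace.single i (1 : ℝ)) * w i = L w := by
    conv_rhs => rw [← (EuclideanSpace.basisFun (Fin N) ℝ).sum_repr w]
    simp [map_sum, mul_comm]
  rw [← key α' x, ← key β' (x - y)]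
  have h3 (e : EuclideanSpace ℝ (Fin N)) : fderiv ℝ (fderiv ℝ f) x e e =
      ⟪α x • e + α' e • x + (β x • e + β' e • (x - y)), e⟫ := by
    rw [h2.fderiv]; rfl
  simp [lap, iteratedFDeriv_two_apply, h3, inner_add_left, inner_sub_left, inner_smul_left,
    EuclideanSpace.inner_single_right, Finset.sum_add_distrib]
  ring

theorem integral_rpow_mul_one_add_rpow {a r : ℝ} (ha : 0 < a) (hr : 0 ≤ r) :
    ∫ v in (0:ℝ)..r, v ^ (a - 1) * (v + 1) ^ (-(a + 1)) = (r ^ a * (r + 1) ^ (-a)) / a := by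
  have hcont (b : ℝ) : ContinuousOn (fun v : ℝ => (v + 1) ^ b) (Set.Icc 0 r) :=
    ContinuousOn.rpow_const (by fun_prop) fun v hv => Or.inl (by linarith [hv.1])
  have h := intervalIntegral.integral_eq_sub_of_hasDerivAt_of_le hr
    (f := fun v : ℝ => (v ^ a * (v + 1) ^ (-a)) / a)
    (f' := fun v : ℝ => v ^ (a - 1) * (v + 1) ^ (-(a + 1))) ?_ ?_ ?_
  · rw [h]; simp [Real.zero_rpow ha.ne']
  · exact ((continuousOn_id.rpow_const fun v _ => Or.inr ha.le).mul (hcont _)).div_const a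
  · intro v hv
    have hv0 : 0 < v := hv.1
    have hv1 : 0 < v + 1 := by linarith
    refine (((Real.hasDerivAt_rpow_const (p := a) (Or.inl hv0.ne')).mul
      (((hasDerivAt_id v).add_const 1).rpow_const (p := -a) (Or.inl hv1.ne'))).div_const
        a).congr_deriv ?_
    have e1 : v ^ a = v ^ (a - 1) * v := by
      rw [← Real.rpow_add_one hv0.ne']; ring_nf
    have e2 : (v + 1) ^ (-a) = (v + 1) ^ (-(a + 1)) * (v + 1) := by
      rw [← Real.rpow_add_one hv1.ne']; ring_nf
    have e3 : (v + 1) ^ (-a - 1) = (v + 1) ^ (-(a + 1)) := by ring_nf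
    simp only [id, e1, e2, e3]
    field_simp
    ring
  · refine (intervalIntegral.intervalIntegrable_rpow' (by linarith)).mul_continuousOn ?_
    rw [Set.uIcc_of_le hr]
    exact hcont _

theorem hasDerivAt_integral_rpow_mul_one_add_rpow {a b r : ℝ} (ha : 0 ≤ a) (hr : 0 < r) :
    HasDerivAt (fun u => ∫ v in (0:ℝ)..u, v ^ a * (v + 1) ^ b) (r ^ a * (r + 1) ^ b) r := by
  have hcont : ContinuousOn (fun v : ℝ => v ^ a * (v + 1) ^ b) (Set.Ioi (-1)) :=
    (continuousOn_id.rpow_const fun v _ => Or.inr ha).mul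
      (ContinuousOn.rpow_const (by fun_prop) fun v hv => Or.inl (by
        have : -1 < v := hv
        linarith))
  have hmem : Set.Ioi (-1 : ℝ) ∈ nhds r := Ioi_mem_nhds (by linarith)
  refine intervalIntegral.integral_hasDerivAt_right ?_
    (hcont.stronglyMeasurableAtFilter isOpen_Ioi r (by
      have : (-1 : ℝ) < r := by linarith
      exact this)) (hcont.continuousAt hmem)
  refine (hcont.mono ?_).intervalIntegrable
  rw [Set.uIcc_of_le hr.le]
  intro v hv
  have := hv.1
  exact Set.mem_Ioi.2 (by linarith)

theorem boggioConst_sub_one (N : ℕ) {s : ℝ} (hs : 1 < s) :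
    boggioConst N (s - 1) = 4 * (s - 1) ^ 2 * boggioConst N s := by
  have hs1 : s - 1 ≠ 0 := by linarith
  have hG : Real.Gamma s = (s - 1) * Real.Gamma (s - 1) := by
    rw [← Real.Gamma_add_one hs1]; ring_nf
  have hGpos : Real.Gamma (s - 1) ≠ 0 := (Real.Gamma_pos_of_pos (by linarith)).ne'
  have h4 : (4 : ℝ) ^ s = 4 * 4 ^ (s - 1) := by
    rw [Real.rpow_sub_one (by norm_num)]; ring
  unfold boggioConst
  rw [hG, h4]
  have := Real.rpow_pos_of_pos (by norm_num : (0 : ℝ) < 4) (s - 1)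
  have := Real.rpow_pos_of_pos Real.pi_pos ((N : ℝ) / 2)
  field_simp

theorem hasFDerivAt_one_sub_norm_sq {E : Type*} [NormedAddCommGroup E] [InnerProductSpace ℝ E]
    (z : E) : HasFDerivAt (fun z : E => 1 - ‖z‖ ^ 2) ((-2 : ℝ) • innerSL ℝ z) z := by
  refine ((hasStrictFDerivAt_norm_sq z).hasFDerivAt.const_sub 1).congr_fderiv ?_
  ext w; simp [two_mul]

theorem hasFDerivAt_norm_sub_sq {E : Type*} [NormedAddCommGroup E] [InnerProductSpace ℝ E]
    (y z : E) : HasFDerivAt (fun z : E => ‖z - y‖ ^ 2) ((2 : ℝ) • innerSL ℝ (z - y)) z := by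
  refine ((hasStrictFDerivAt_norm_sq (z - y)).hasFDerivAt.comp z
    ((hasFDerivAt_id z).sub_const y)).congr_fderiv ?_
  ext w; simp [two_mul]

/-- The density of Boggio's integral at `ρ = A B / D`, in terms of `Q = D + A B = D (ρ + 1)`. -/
theorem boggio_density_eq {a A B D : ℝ} (hA : 0 < A) (hB : 0 < B) (hD : 0 < D) :
    (A * B / D) ^ a * (A * B / D + 1) ^ (-(a + 1)) =
      A ^ a * B ^ a * D * (D + A * B) ^ (-(a + 1)) := by
  have h1 : A * B / D + 1 = (D + A * B) / D := by field_simp; ring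
  have hQ : 0 < D + A * B := by positivity
  rw [h1, Real.div_rpow (by positivity) hD.le, Real.div_rpow hQ.le hD.le,
    Real.mul_rpow hA.le hB.le, Real.rpow_neg hD.le, Real.rpow_add_one hD.ne']
  have := Real.rpow_pos_of_pos hD a
  field_simp

theorem hasFDerivAt_boggio_integral {N : ℕ} {a k : ℝ} (ha : 0 ≤ a)
    {y z : EuclideanSpace ℝ (Fin N)} (hz : ‖z‖ < 1) (hy : ‖y‖ < 1) (hzy : z ≠ y) :
    HasFDerivAt
      (fun z => k * ∫ v in (0:ℝ)..(boggioRho z y), v ^ a * (v + 1) ^ (-(a + 1)))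
      (innerSL ℝ
        ((-2 * k * (1 - ‖y‖ ^ 2) ^ (a + 1) * ((1 - ‖z‖ ^ 2) ^ a *
            (‖z - y‖ ^ 2 + (1 - ‖z‖ ^ 2) * (1 - ‖y‖ ^ 2)) ^ (-(a + 1)))) • z +
          (-2 * k * (1 - ‖y‖ ^ 2) ^ (a + 1) * ((1 - ‖z‖ ^ 2) ^ (a + 1) *
            (‖z - y‖ ^ 2 + (1 - ‖z‖ ^ 2) * (1 - ‖y‖ ^ 2)) ^ (-(a + 1)) *
              (‖z - y‖ ^ 2)⁻¹)) • (z - y))) z := by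
  have hA : 0 < 1 - ‖z‖ ^ 2 := by nlinarith [norm_nonneg z]
  have hB : 0 < 1 - ‖y‖ ^ 2 := by nlinarith [norm_nonneg y]
  have hn : ‖z - y‖ ≠ 0 := norm_ne_zero_iff.2 (sub_ne_zero.2 hzy)
  have hD : 0 < ‖z - y‖ ^ 2 := by positivity
  have hρ : HasFDerivAt (fun z => boggioRho z y) _ z :=
    ((hasFDerivAt_one_sub_norm_sq z).mul_const (1 - ‖y‖ ^ 2)).mul
      ((hasDerivAt_inv hD.ne').comp_hasFDerivAt z (hasFDerivAt_norm_sub_sq y z))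
  have hρpos : 0 < boggioRho z y := div_pos (mul_pos hA hB) hD
  refine (((hasDerivAt_integral_rpow_mul_one_add_rpow (b := -(a + 1)) ha
    hρpos).comp_hasFDerivAt z hρ).const_mul k).congr_fderiv ?_
  have hg := boggio_density_eq (a := a) hA hB hD
  unfold boggioRho
  rw [hg, Real.rpow_add_one hA.ne', Real.rpow_add_one hB.ne']
  generalize (‖z - y‖ ^ 2 + (1 - ‖z‖ ^ 2) * (1 - ‖y‖ ^ 2)) ^ (-(a + 1)) = R
  ext w
  simp only [smul_apply, add_apply, innerSL_apply_apply,
    inner_add_left, real_inner_smul_left, smul_eq_mul]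
  field_simp
  ring

theorem boggio_recurrence_conformal_case
    (N : ℕ) (hN : 3 ≤ N) (x y : EuclideanSpace ℝ (Fin N))
    (hx : x ∈ Metric.ball (0 : EuclideanSpace ℝ (Fin N)) 1)
    (hy : y ∈ Metric.ball (0 : EuclideanSpace ℝ (Fin N)) 1) (hxy : x ≠ y) :
    -lap (fun z => boggioConst N ((N : ℝ) / 2) *
        ∫ v in (0:ℝ)..(boggioRho z y), v ^ ((N : ℝ) / 2 - 1) * (v + 1) ^ (-((N : ℝ) / 2))) x
      = boggioConst N ((N : ℝ) / 2 - 1) * ‖x - y‖ ^ (-(2:ℝ)) *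
          (∫ v in (0:ℝ)..(boggioRho x y), v ^ ((N : ℝ) / 2 - 2) * (v + 1) ^ (-((N : ℝ) / 2)))
        - 4 * boggioConst N ((N : ℝ) / 2) * ((N : ℝ) / 2 - 1) *
            ((1 - ‖x‖ ^ 2) ^ ((N : ℝ) / 2 - 2) * (1 - ‖y‖ ^ 2) ^ ((N : ℝ) / 2 - 1) *
              (1 - ‖x‖ ^ 2 * ‖y‖ ^ 2) /
              (Real.sqrt (‖x‖ ^ 2 * ‖y‖ ^ 2 - 2 * ⟪x, y⟫ + 1)) ^ (N : ℕ)) := by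
  have hx1 : ‖x‖ < 1 := by simpa using hx
  have hy1 : ‖y‖ < 1 := by simpa using hy
  obtain ⟨a, ha⟩ : ∃ a : ℝ, (N : ℝ) / 2 = a + 1 := ⟨N / 2 - 1, by ring⟩
  have hNa : (N : ℝ) = 2 * (a + 1) := by linarith
  have ha0 : 0 < a := by
    have : (3 : ℝ) ≤ N := by exact_mod_cast hN
    linarith
  rw [ha, boggioConst_sub_one N (by linarith : 1 < a + 1)]
  have e1 : a + 1 - 1 = a := by ring
  have e2 : a + 1 - 2 = a - 1 := by ring
  rw [e1, e2]
  generalize boggioConst N (a + 1) = k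
  have hA : 0 < 1 - ‖x‖ ^ 2 := by nlinarith [norm_nonneg x]
  have hB : 0 < 1 - ‖y‖ ^ 2 := by nlinarith [norm_nonneg y]
  have hn : ‖x - y‖ ≠ 0 := norm_ne_zero_iff.2 (sub_ne_zero.2 hxy)
  have hD : 0 < ‖x - y‖ ^ 2 := by positivity
  have hQ : 0 < ‖x - y‖ ^ 2 + (1 - ‖x‖ ^ 2) * (1 - ‖y‖ ^ 2) := by positivity
  have hρ : 0 < boggioRho x y := div_pos (mul_pos hA hB) hD
  rw [integral_rpow_mul_one_add_rpow ha0 hρ.le]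
  have hev : ∀ᶠ z in nhds x, ‖z‖ < 1 ∧ z ≠ y :=
    (continuous_norm.continuousAt.eventually_lt_const hx1).and (isOpen_ne.mem_nhds hxy)
  have hA' := hasFDerivAt_one_sub_norm_sq x
  have hD' := hasFDerivAt_norm_sub_sq y x
  have hQ' := (hD'.add (hA'.mul_const (1 - ‖y‖ ^ 2))).rpow_const (p := -(a + 1)) (Or.inl hQ.ne')
  rw [lap_eq_div (hev.mono fun z hz => hasFDerivAt_boggio_integral ha0.le hz.1 hy1 hz.2)
    (((hA'.rpow_const (p := a) (Or.inl hA.ne')).mul hQ').const_mul _)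
    ((((hA'.rpow_const (p := a + 1) (Or.inl hA.ne')).mul hQ').mul
      ((hasDerivAt_inv hD.ne').comp_hasFDerivAt x hD')).const_mul _)]
  have hxy2 : ‖x - y‖ ^ 2 = ‖x‖ ^ 2 - 2 * ⟪x, y⟫ + ‖y‖ ^ 2 := norm_sub_sq_real x y
  have hsqrt : Real.sqrt (‖x‖ ^ 2 * ‖y‖ ^ 2 - 2 * ⟪x, y⟫ + 1) ^ N =
      (‖x - y‖ ^ 2 + (1 - ‖x‖ ^ 2) * (1 - ‖y‖ ^ 2)) ^ (a + 1) := by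
    have : ‖x‖ ^ 2 * ‖y‖ ^ 2 - 2 * ⟪x, y⟫ + 1 =
        ‖x - y‖ ^ 2 + (1 - ‖x‖ ^ 2) * (1 - ‖y‖ ^ 2) := by rw [hxy2]; ring
    rw [this, Real.sqrt_eq_rpow, ← Real.rpow_mul_natCast hQ.le, hNa]
    ring_nf
  have hfrac : boggioRho x y ^ a * (boggioRho x y + 1) ^ (-a) =
      (1 - ‖x‖ ^ 2) ^ a * (1 - ‖y‖ ^ 2) ^ a *
        (‖x - y‖ ^ 2 + (1 - ‖x‖ ^ 2) * (1 - ‖y‖ ^ 2)) ^ (-a) := by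
    have hρ1 : boggioRho x y + 1 ≠ 0 := by positivity
    have h := boggio_density_eq (a := a) hA hB hD
    have e3 : boggioRho x y + 1 =
        (‖x - y‖ ^ 2 + (1 - ‖x‖ ^ 2) * (1 - ‖y‖ ^ 2)) / ‖x - y‖ ^ 2 := by
      unfold boggioRho; field_simp; ring
    have e4 (q : ℝ) (hq : q ≠ 0) : q ^ (-a) = q ^ (-(a + 1)) * q := by
      rw [← Real.rpow_add_one hq]; ring_nf
    rw [e4 _ hρ1, e4 _ hQ.ne', ← mul_assoc]
    change boggioRho x y ^ a * (boggioRho x y + 1) ^ (-(a + 1)) = _ at h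
    rw [h, e3]
    field_simp
  have hD2 : ‖x - y‖ ^ (-(2:ℝ)) = (‖x - y‖ ^ 2)⁻¹ := by
    rw [Real.rpow_neg (norm_nonneg _)]; norm_cast
  have hxx : ⟪x, x⟫ = ‖x‖ ^ 2 := real_inner_self_eq_norm_sq x
  have hdx : ⟪x - y, x⟫ = ‖x‖ ^ 2 - ⟪x, y⟫ := by
    rw [inner_sub_left, hxx, real_inner_comm]
  have hxd : ⟪x, x - y⟫ = ‖x‖ ^ 2 - ⟪x, y⟫ := by rw [inner_sub_right, hxx]
  have hdd : ⟪x - y, x - y⟫ = ‖x - y‖ ^ 2 := real_inner_self_eq_norm_sq _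
  have hp : ⟪x, y⟫ = (‖x‖ ^ 2 + ‖y‖ ^ 2 - ‖x - y‖ ^ 2) / 2 := by linarith
  rw [hsqrt, hfrac, hD2]
  simp only [smul_apply, add_apply, innerSL_apply_apply,
    smul_eq_mul, Function.comp_apply, Pi.add_apply, Pi.mul_apply, hxx, hdx, hxd, hdd, hp, hNa]
  generalize ‖x - y‖ ^ 2 = D at *
  generalize hAe : 1 - ‖x‖ ^ 2 = A at *
  generalize hBe : 1 - ‖y‖ ^ 2 = B at *
  have hxA : ‖x‖ ^ 2 = 1 - A := by linarith
  have hyB : ‖y‖ ^ 2 = 1 - B := by linarith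
  have hQa : (D + A * B) ^ (-(a + 1) - 1) = ((D + A * B) ^ a * (D + A * B) ^ 2)⁻¹ := by
    rw [← Real.rpow_natCast, ← Real.rpow_add hQ, ← Real.rpow_neg hQ.le]
    push_cast
    ring_nf
  have hAa : A ^ (a - 1) = A ^ a / A := Real.rpow_sub_one hA.ne' a
  rw [hQa, hAa, e1, Real.rpow_neg hQ.le, Real.rpow_neg hQ.le, Real.rpow_add_one hQ.ne',
    Real.rpow_add_one hA.ne', Real.rpow_add_one hB.ne', hxA, hyB]
  have hQp := Real.rpow_pos_of_pos hQ a
  generalize (D + A * B) ^ a = S at *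
  field_simp
  ring
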